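/- Let Φ be a finite set of propositional variables and let P be a team property (a collection of pairs (M,T) with T a nonempty team of M). Suppose P is expressed by a first-order sentence over σ_Φ (i.e., there is a σ_Φ-sentence ψ with (M,T)∈P iff A(M,T)⊨ψ for all M,T) and P is invariant under full team bisimulation. Then P is local: there exists d∈ℕ such that for all Kripke models M and nonempty teams T, (M,T)∈P if and only if (M↾N_d(T), T)∈P. -/

import Mathlib

/-- A Kripke model over propositional variables `Φ` with worlds `W`. -/
structure KripkeModel (Φ : Type) (W : Type) : Type where
  nonempty : Nonempty W
  R : W → W → Prop
  val : Φ → Set W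

/-- ML formulas in negation normal form. -/
inductive MLFormula (Φ : Type) : Type
  | pos : Φ → MLFormula Φ
  | neg : Φ → MLFormula Φ
  | and : MLFormula Φ → MLFormula Φ → MLFormula Φ
  | or  : MLFormula Φ → MLFormula Φ → MLFormula Φ
  | dia : MLFormula Φ → MLFormula Φ
  | box : MLFormula Φ → MLFormula Φ

variable {Φ W W₁ W₂ : Type}

/-- Team semantics for ML. -/
def MLTeamSat (M : KripkeModel Φ W) : MLFormula Φ → Set W → Prop
  | .pos p, T => T ⊆ M.val p
  | .neg p, T => T ∩ M.val p = ∅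
  | .and φ ψ, T => MLTeamSat M φ T ∧ MLTeamSat M ψ T
  | .or φ ψ, T => ∃ T₁ T₂, T = T₁ ∪ T₂ ∧ MLTeamSat M φ T₁ ∧ MLTeamSat M ψ T₂
  | .dia φ, T => ∃ T', MLTeamSat M φ T' ∧ (∀ w ∈ T, ∃ w' ∈ T', M.R w w') ∧
      (∀ w' ∈ T', ∃ w ∈ T, M.R w w')
  | .box φ, T => MLTeamSat M φ {w' | ∃ w ∈ T, M.R w w'}

/-- Standard single-world Kripke semantics for ML. -/
def MLWorldSat (M : KripkeModel Φ W) : MLFormula Φ → W → Prop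
  | .pos p, w => w ∈ M.val p
  | .neg p, w => w ∉ M.val p
  | .and φ ψ, w => MLWorldSat M φ w ∧ MLWorldSat M ψ w
  | .or φ ψ, w => MLWorldSat M φ w ∨ MLWorldSat M ψ w
  | .dia φ, w => ∃ w', M.R w w' ∧ MLWorldSat M φ w'
  | .box φ, w => ∀ w', M.R w w' → MLWorldSat M φ w'

/-- Modal depth of an ML formula. -/
def MLmd : MLFormula Φ → ℕ
  | .pos _ => 0
  | .neg _ => 0
  | .and φ ψ => max (MLmd φ) (MLmd ψ)
  | .or φ ψ => max (MLmd φ) (MLmd ψ)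
  | .dia φ => MLmd φ + 1
  | .box φ => MLmd φ + 1

/-- `k`-bisimilarity of pointed Kripke models. -/
def kBisim (M₁ : KripkeModel Φ W₁) (M₂ : KripkeModel Φ W₂) : ℕ → W₁ → W₂ → Prop
  | 0, w₁, w₂ => ∀ p, w₁ ∈ M₁.val p ↔ w₂ ∈ M₂.val p
  | k+1, w₁, w₂ => (∀ p, w₁ ∈ M₁.val p ↔ w₂ ∈ M₂.val p)
      ∧ (∀ w₁', M₁.R w₁ w₁' → ∃ w₂', M₂.R w₂ w₂' ∧ kBisim M₁ M₂ k w₁' w₂')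
      ∧ (∀ w₂', M₂.R w₂ w₂' → ∃ w₁', M₁.R w₁ w₁' ∧ kBisim M₁ M₂ k w₁' w₂')

/-- `k`-bisimilarity of teams. -/
def teamKBisim (M₁ : KripkeModel Φ W₁) (M₂ : KripkeModel Φ W₂) (k : ℕ)
    (T₁ : Set W₁) (T₂ : Set W₂) : Prop :=
  (∀ w₁ ∈ T₁, ∃ w₂ ∈ T₂, kBisim M₁ M₂ k w₁ w₂) ∧
  (∀ w₂ ∈ T₂, ∃ w₁ ∈ T₁, kBisim M₁ M₂ k w₁ w₂)

/-- Full team bisimilarity. -/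
def teamBisim (M₁ : KripkeModel Φ W₁) (M₂ : KripkeModel Φ W₂)
    (T₁ : Set W₁) (T₂ : Set W₂) : Prop :=
  ∃ Z : W₁ → W₂ → Prop,
    (∀ w₁ w₂, Z w₁ w₂ →
      (∀ p, w₁ ∈ M₁.val p ↔ w₂ ∈ M₂.val p)
      ∧ (∀ w₁', M₁.R w₁ w₁' → ∃ w₂', M₂.R w₂ w₂' ∧ Z w₁' w₂')
      ∧ (∀ w₂', M₂.R w₂ w₂' → ∃ w₁', M₁.R w₁ w₁' ∧ Z w₁' w₂')) ∧
    (∀ w₁ ∈ T₁, ∃ w₂ ∈ T₂, Z w₁ w₂) ∧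
    (∀ w₂ ∈ T₂, ∃ w₁ ∈ T₁, Z w₁ w₂)

/-- MTL formulas: ML plus classical negation `∼`. -/
inductive MTLFormula (Φ : Type) : Type
  | pos : Φ → MTLFormula Φ
  | neg : Φ → MTLFormula Φ
  | cneg : MTLFormula Φ → MTLFormula Φ
  | and : MTLFormula Φ → MTLFormula Φ → MTLFormula Φ
  | or  : MTLFormula Φ → MTLFormula Φ → MTLFormula Φ
  | dia : MTLFormula Φ → MTLFormula Φ
  | box : MTLFormula Φ → MTLFormula Φ

/-- Team semantics for MTL. -/
def MTLTeamSat (M : KripkeModel Φ W) : MTLFormula Φ → Set W → Prop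
  | .pos p, T => T ⊆ M.val p
  | .neg p, T => T ∩ M.val p = ∅
  | .cneg φ, T => ¬ MTLTeamSat M φ T
  | .and φ ψ, T => MTLTeamSat M φ T ∧ MTLTeamSat M ψ T
  | .or φ ψ, T => ∃ T₁ T₂, T = T₁ ∪ T₂ ∧ MTLTeamSat M φ T₁ ∧ MTLTeamSat M ψ T₂
  | .dia φ, T => ∃ T', MTLTeamSat M φ T' ∧ (∀ w ∈ T, ∃ w' ∈ T', M.R w w') ∧
      (∀ w' ∈ T', ∃ w ∈ T, M.R w w')
  | .box φ, T => MTLTeamSat M φ {w' | ∃ w ∈ T, M.R w w'}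

/-- Modal depth of an MTL formula. -/
def MTLmd : MTLFormula Φ → ℕ
  | .pos _ => 0
  | .neg _ => 0
  | .cneg φ => MTLmd φ
  | .and φ ψ => max (MTLmd φ) (MTLmd ψ)
  | .or φ ψ => max (MTLmd φ) (MTLmd ψ)
  | .dia φ => MTLmd φ + 1
  | .box φ => MTLmd φ + 1



/-- Relation symbols of the first-order signature `σ_Φ`: one unary symbol for the team
(`Option.none`), one unary symbol `W_p` for each `p ∈ Φ` (`Option.some p`), and one
binary symbol `E` for the accessibility relation. -/
def sigmaRel (Φ : Type) : ℕ → Type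
  | 1 => Option Φ
  | 2 => Unit
  | _ => Empty

/-- The first-order signature `σ_Φ`. -/
def sigmaLang (Φ : Type) : FirstOrder.Language where
  Functions := fun _ => Empty
  Relations := sigmaRel Φ

/-- The `σ_Φ`-structure `A(M,T)` determined by a Kripke model `M` and a team `T`. -/
def foStruct (M : KripkeModel Φ W) (T : Set W) : (sigmaLang Φ).Structure W where
  funMap := fun {n} f _ => (f : Empty).elim
  RelMap := fun {n} => match n with
    | 1 => fun r xs => match r with
      | Option.none => xs 0 ∈ T
      | Option.some p => xs 0 ∈ M.val p
    | 2 => fun _ xs => M.R (xs 0) (xs 1)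
    | 0 => fun r _ => (r : Empty).elim
    | (_+3) => fun r _ => (r : Empty).elim

/-- Satisfaction of a `σ_Φ`-sentence in `A(M,T)`. -/
def foSat (M : KripkeModel Φ W) (T : Set W) (ψ : (sigmaLang Φ).Sentence) : Prop :=
  @FirstOrder.Language.Sentence.Realize (sigmaLang Φ) W (foStruct M T) ψ

/-- `reachLE M d w w'` holds iff there is an `R`-path of length at most `d`
from `w` to `w'`, i.e. the distance from `w` to `w'` is at most `d`. -/
def reachLE (M : KripkeModel Φ W) : ℕ → W → W → Prop
  | 0 => fun w w' => w = w'
  | d+1 => fun w w' => w = w' ∨ ∃ u, M.R w u ∧ reachLE M d u w'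

/-- The `d`-neighborhood `N_d(T)` of a team `T`: all worlds at distance at most `d`
from some world of `T`. -/
def nbhd (M : KripkeModel Φ W) (d : ℕ) (T : Set W) : Set W :=
  {w' | ∃ w ∈ T, reachLE M d w w'}

theorem reachLE_self (M : KripkeModel Φ W) (d : ℕ) (w : W) : reachLE M d w w := by
  cases d with
  | zero => rfl
  | succ d => exact Or.inl rfl

theorem subset_nbhd (M : KripkeModel Φ W) (d : ℕ) (T : Set W) : T ⊆ nbhd M d T :=
  fun w hw => ⟨w, hw, reachLE_self M d w⟩

/-- The restriction `M ↾ S` of a Kripke model to a nonempty set `S` of worlds. -/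
def restrict (M : KripkeModel Φ W) (S : Set W) (h : S.Nonempty) : KripkeModel Φ S where
  nonempty := h.to_subtype
  R := fun a b => M.R a b
  val := fun p => {a | (a : W) ∈ M.val p}

open Filter in
/-- The ultraproduct of a family of Kripke models. -/
def ultraModel {α : Type} {X : α → Type} (u : Ultrafilter α) (M : ∀ a, KripkeModel Φ (X a)) :
    KripkeModel Φ ((u : Filter α).Product X) where
  nonempty := ⟨Quotient.mk _ fun a => (M a).nonempty.some⟩
  R := fun x y => Quotient.liftOn₂' x y (fun f g => ∀ᶠ a in u, (M a).R (f a) (g a))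
    fun f g f' g' hf hg => propext <| eventually_congr <| by
      filter_upwards [hf, hg] with a h₁ h₂
      rw [h₁, h₂]
  val := fun p => {x | Quotient.liftOn' x (fun f => ∀ᶠ a in u, f a ∈ (M a).val p)
    fun f f' hf => propext <| eventually_congr <| by
      filter_upwards [hf] with a h₁
      rw [h₁]}

open Filter in
/-- The ultraproduct of a family of teams. -/
def ultraTeam {α : Type} {X : α → Type} (u : Ultrafilter α) (T : ∀ a, Set (X a)) :
    Set ((u : Filter α).Product X) :=
  {x | Quotient.liftOn' x (fun f => ∀ᶠ a in u, f a ∈ T a)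
    fun f f' hf => propext <| eventually_congr <| by
      filter_upwards [hf] with a h₁
      rw [h₁]}

theorem ultraTeam_nonempty {α : Type} {X : α → Type} (u : Ultrafilter α) (T : ∀ a, Set (X a))
    (hT : ∀ a, (T a).Nonempty) : (ultraTeam u T).Nonempty := by
  choose f hf using hT
  exact ⟨Quotient.mk _ f, Filter.Eventually.of_forall hf⟩

open FirstOrder.Language in
theorem foStruct_ultraproduct {α : Type} {X : α → Type} (u : Ultrafilter α)
    (M : ∀ a, KripkeModel Φ (X a)) (T : ∀ a, Set (X a)) :
    foStruct (ultraModel u M) (ultraTeam u T) =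
      @Ultraproduct.structure α X u (sigmaLang Φ) fun a => foStruct (M a) (T a) := by
  let := fun a => foStruct (M a) (T a)
  refine Structure.ext ?_ ?_
  · funext n f
    exact Empty.elim f
  · funext n r xs
    obtain ⟨fs, rfl⟩ : ∃ fs : Fin n → ∀ a, X a,
        xs = fun i => (Quotient.mk _ (fs i) : (u : Filter α).Product X) :=
      ⟨fun i => (xs i).out, funext fun i => ((xs i).out_eq).symm⟩
    refine Eq.trans ?_ (propext (relMap_quotient_mk' (L := sigmaLang Φ)
      (s := (u : Filter α).productSetoid X) r fs)).symm
    match n, r with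
    | 1, none => rfl
    | 1, some p => rfl
    | 2, _ => rfl
    | 0, r => exact Empty.elim r
    | _ + 3, r => exact Empty.elim r

open FirstOrder.Language in
/-- Łoś's theorem for Kripke models with teams. -/
theorem foSat_ultraModel {α : Type} {X : α → Type} (u : Ultrafilter α)
    (M : ∀ a, KripkeModel Φ (X a)) (T : ∀ a, Set (X a)) (ψ : (sigmaLang Φ).Sentence) :
    foSat (ultraModel u M) (ultraTeam u T) ψ ↔ ∀ᶠ a in u, foSat (M a) (T a) ψ := by
  let := fun a => foStruct (M a) (T a)
  have := fun a => (M a).nonempty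
  unfold foSat
  rw [foStruct_ultraproduct]
  exact Ultraproduct.sentence_realize ψ

theorem reachLE_mono (M : KripkeModel Φ W) {m n : ℕ} (h : m ≤ n) {w v : W}
    (hr : reachLE M m w v) : reachLE M n w v := by
  induction n generalizing m w with
  | zero => obtain rfl := Nat.le_zero.mp h; exact hr
  | succ n ih =>
    cases m with
    | zero => exact Or.inl hr
    | succ m =>
      exact hr.imp_right fun ⟨u, hu, hr⟩ => ⟨u, hu, ih (Nat.le_of_succ_le_succ h) hr⟩

theorem reachLE_succ_of_R (M : KripkeModel Φ W) {n : ℕ} {w v v' : W}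
    (hr : reachLE M n w v) (h : M.R v v') : reachLE M (n + 1) w v' := by
  induction n generalizing w with
  | zero => obtain rfl : w = v := hr; exact Or.inr ⟨v', h, rfl⟩
  | succ n ih =>
    rcases hr with rfl | ⟨u, hu, hr⟩
    · exact Or.inr ⟨v', h, reachLE_self M _ v'⟩
    · exact Or.inr ⟨u, hu, ih hr⟩

theorem nbhd_mono (M : KripkeModel Φ W) {m n : ℕ} (h : m ≤ n) (T : Set W) :
    nbhd M m T ⊆ nbhd M n T :=
  fun _ ⟨w, hw, hr⟩ => ⟨w, hw, reachLE_mono M h hr⟩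

theorem nbhd_succ_of_R (M : KripkeModel Φ W) {n : ℕ} {T : Set W} {v v' : W}
    (hv : v ∈ nbhd M n T) (h : M.R v v') : v' ∈ nbhd M (n + 1) T :=
  let ⟨w, hw, hr⟩ := hv
  ⟨w, hw, reachLE_succ_of_R M hr h⟩

open Filter in
/-- The ultraproduct of models `M d` and that of their restrictions to the `d`-neighborhoods of
teams `T d` are team-bisimilar, along a nonprincipal ultrafilter on `ℕ`: both contain all the
worlds at finite distance from the team. -/
theorem teamBisim_ultraModel_restrict_nbhd (u : Ultrafilter ℕ) (hu : (u : Filter ℕ) ≤ atTop)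
    {X : ℕ → Type} (M : ∀ d, KripkeModel Φ (X d)) (T : ∀ d, Set (X d))
    (hN : ∀ d, (nbhd (M d) d (T d)).Nonempty) :
    teamBisim (ultraModel u M)
      (ultraModel u fun d => restrict (M d) (nbhd (M d) d (T d)) (hN d))
      (ultraTeam u T) (ultraTeam u fun d => Subtype.val ⁻¹' T d) := by
  classical
  have lift : ∀ (n : ℕ) (f : ∀ d, X d), (∀ᶠ d in u, f d ∈ nbhd (M d) n (T d)) →
      ∃ g : ∀ d, nbhd (M d) d (T d), ∀ᶠ d in u, (g d : X d) = f d := by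
    intro n f hf
    refine ⟨fun d => if h : f d ∈ nbhd (M d) d (T d) then ⟨f d, h⟩ else (hN d).to_subtype.some, ?_⟩
    filter_upwards [hf, hu (eventually_ge_atTop n)] with d hd hn
    rw [dif_pos (nbhd_mono (M d) hn (T d) hd)]
  refine ⟨fun x y => ∃ (n : ℕ) (f : ∀ d, X d) (g : ∀ d, nbhd (M d) d (T d)),
    x = Quotient.mk _ f ∧ y = Quotient.mk _ g ∧ (∀ᶠ d in u, (g d : X d) = f d) ∧
      ∀ᶠ d in u, f d ∈ nbhd (M d) n (T d), ?_, ?_, ?_⟩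
  · rintro _ _ ⟨n, f, g, rfl, rfl, hfg, hn⟩
    refine ⟨fun p => eventually_congr ?_, ?_, ?_⟩
    · filter_upwards [hfg] with d hd
      rw [← hd]
      rfl
    · intro x' hR
      induction x' using Quotient.inductionOn with | _ f'
      change ∀ᶠ d in u, (M d).R (f d) (f' d) at hR
      have hn' : ∀ᶠ d in u, f' d ∈ nbhd (M d) (n + 1) (T d) := by
        filter_upwards [hn, hR] with d h₁ h₂ using nbhd_succ_of_R (M d) h₁ h₂
      obtain ⟨g', hg'⟩ := lift (n + 1) f' hn'
      refine ⟨Quotient.mk _ g', ?_, n + 1, f', g', rfl, rfl, hg', hn'⟩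
      change ∀ᶠ d in u, (M d).R (g d) (g' d)
      filter_upwards [hfg, hg', hR] with d h₁ h₂ h₃
      rwa [h₁, h₂]
    · intro y' hR
      induction y' using Quotient.inductionOn with | _ g'
      change ∀ᶠ d in u, (M d).R (g d) (g' d) at hR
      have hR' : ∀ᶠ d in u, (M d).R (f d) (g' d) := by
        filter_upwards [hfg, hR] with d h₁ h₂
        rwa [← h₁]
      refine ⟨Quotient.mk _ fun d => (g' d : X d), hR', n + 1, _, g', rfl, rfl,
        Eventually.of_forall fun _ => rfl, ?_⟩
      filter_upwards [hn, hR'] with d h₁ h₂ using nbhd_succ_of_R (M d) h₁ h₂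
  · intro x hx
    induction x using Quotient.inductionOn with | _ f
    change ∀ᶠ d in u, f d ∈ T d at hx
    have h0 : ∀ᶠ d in u, f d ∈ nbhd (M d) 0 (T d) := by
      filter_upwards [hx] with d hd using subset_nbhd (M d) 0 (T d) hd
    obtain ⟨g, hg⟩ := lift 0 f h0
    refine ⟨Quotient.mk _ g, ?_, 0, f, g, rfl, rfl, hg, h0⟩
    change ∀ᶠ d in u, (g d : X d) ∈ T d
    filter_upwards [hx, hg] with d h₁ h₂
    rwa [h₂]
  · intro y hy
    induction y using Quotient.inductionOn with | _ g
    change ∀ᶠ d in u, (g d : X d) ∈ T d at hy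
    refine ⟨Quotient.mk _ fun d => (g d : X d), hy, 0, _, g, rfl, rfl,
      Eventually.of_forall fun _ => rfl, ?_⟩
    filter_upwards [hy] with d hd using subset_nbhd (M d) 0 (T d) hd

theorem teamBisim.symm {M₁ : KripkeModel Φ W₁} {M₂ : KripkeModel Φ W₂} {T₁ : Set W₁}
    {T₂ : Set W₂} (h : teamBisim M₁ M₂ T₁ T₂) : teamBisim M₂ M₁ T₂ T₁ := by
  obtain ⟨Z, hZ, h₁, h₂⟩ := h
  refine ⟨fun y x => Z x y, fun y x hyx => ?_, h₂, h₁⟩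
  obtain ⟨hp, hf, hb⟩ := hZ x y hyx
  exact ⟨fun p => (hp p).symm, hb, hf⟩

/-- A team property expressed by a first-order sentence over `σ_Φ` and invariant under
full team bisimulation is local: for some `d`, membership of `(M,T)` only depends on
the restriction of `M` to the `d`-neighborhood of `T`. -/
theorem FO_teamBisim_invariant_implies_local [Finite Φ]
    (P : ∀ W : Type, KripkeModel Φ W → Set W → Prop)
    (ψ : (sigmaLang Φ).Sentence)
    (hFO : ∀ (W : Type) (M : KripkeModel Φ W) (T : Set W),
      T.Nonempty → (P W M T ↔ foSat M T ψ))
    (hinv : ∀ (W₁ W₂ : Type) (M₁ : KripkeModel Φ W₁) (M₂ : KripkeModel Φ W₂)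
      (T₁ : Set W₁) (T₂ : Set W₂), T₁.Nonempty → T₂.Nonempty →
      P W₁ M₁ T₁ → teamBisim M₁ M₂ T₁ T₂ → P W₂ M₂ T₂) :
    ∃ d : ℕ, ∀ (W : Type) (M : KripkeModel Φ W) (T : Set W) (hT : T.Nonempty),
      P W M T ↔
        P (nbhd M d T)
          (restrict M (nbhd M d T) (hT.mono (subset_nbhd M d T)))
          (Subtype.val ⁻¹' T) := by
  by_contra! hcon
  choose X M T hT hne using hcon
  let u : Ultrafilter ℕ := Filter.hyperfilter ℕ
  have hN := fun d => (hT d).mono (subset_nbhd (M d) d (T d))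
  have hT' : ∀ d, (Subtype.val ⁻¹' T d : Set (nbhd (M d) d (T d))).Nonempty := fun d =>
    let ⟨w, hw⟩ := hT d
    ⟨⟨w, subset_nbhd (M d) d (T d) hw⟩, hw⟩
  have hbis := teamBisim_ultraModel_restrict_nbhd u Nat.hyperfilter_le_atTop M T hN
  have hU := ultraTeam_nonempty u T hT
  have hU' := ultraTeam_nonempty u _ hT'
  have hP : P _ (ultraModel u M) (ultraTeam u T) ↔ P _ _ _ :=
    ⟨fun h => hinv _ _ _ _ _ _ hU hU' h hbis, fun h => hinv _ _ _ _ _ _ hU' hU h hbis.symm⟩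
  rw [hFO _ _ _ hU, hFO _ _ _ hU', foSat_ultraModel, foSat_ultraModel] at hP
  have hneg : ∀ d, foSat (M d) (T d) ψ ↔
      ¬ foSat (restrict (M d) (nbhd (M d) d (T d)) (hN d)) (Subtype.val ⁻¹' T d) ψ := by
    intro d
    have := hne d
    rw [hFO _ _ _ (hT d), hFO _ _ _ (hT' d)] at this
    tauto
  rw [Filter.eventually_congr (Filter.Eventually.of_forall hneg), Ultrafilter.eventually_not] at hP
  tauto
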